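/- Let A be a symmetric real 3×3 matrix such that Ā = (tr(A)I − A)/2 is positive definite. Let R̃ : [0,∞) → ℝ^{3×3} be differentiable with R̃(t) ∈ SO(3) and R̃'(t) = R̃(t)[σ(t)]_× where σ(t) = −ψ(A R̃(t)), and suppose |R̃(0)|_I < 1. Then the function t ↦ |R̃(t)|_I² is differentiable with (d/dt)|R̃(t)|_I² = −tr(A(I − R̃(t)²))/8, and it satisfies the differential inequality −2 λ_max(Ā)(1 − |R̃(t)|_I²)|R̃(t)|_I² ≤ (d/dt)|R̃(t)|_I² ≤ −2 λ_min(Ā)(1 − |R̃(t)|_I²)|R̃(t)|_I² for all t ≥ 0. -/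

import Mathlib

open Matrix Filter

noncomputable section

attribute [local instance] Matrix.normedAddCommGroup Matrix.normedSpace

/-- 3×3 real matrices. -/
abbrev M3 := Matrix (Fin 3) (Fin 3) ℝ
/-- vectors in ℝ³. -/
abbrev V3 := Fin 3 → ℝ

/-- `R ∈ SO(3)`: `RᵀR = I` and `det R = 1`. -/
def SO3 (R : M3) : Prop := Rᵀ * R = 1 ∧ R.det = 1

/-- The skew-symmetric matrix `[x]ₓ` with `[x]ₓ y = x × y`. -/
def skew (x : V3) : M3 :=
  !![0, -x 2, x 1; x 2, 0, -x 0; -x 1, x 0, 0]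

/-- Inverse of `skew` on skew-symmetric matrices. -/
def vex (M : M3) : V3 := ![M 2 1, M 0 2, M 1 0]

/-- Anti-symmetric projection `P_a(M) = (M - Mᵀ)/2`. -/
def Pa (M : M3) : M3 := (2:ℝ)⁻¹ • (M - Mᵀ)

/-- `ψ(M) = vex(P_a(M))`. -/
def psi (M : M3) : V3 := vex (Pa M)

/-- Squared normalized Euclidean distance `|R|_I² = tr(I - R)/4`. -/
def normI2 (R : M3) : ℝ := (1 - R).trace / 4

/-- Rodrigues vector `Z(R) = ψ(R)/(2(1 - |R|_I²))`. -/
def Zof (R : M3) : V3 := (2 * (1 - normI2 R))⁻¹ • psi R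

/-- Cayley map `R_r(z) = (I + [z]ₓ)(I - [z]ₓ)⁻¹`. -/
def Rr (z : V3) : M3 := (1 + skew z) * (1 - skew z)⁻¹

/-- Angle-axis map `R_a(θ,u) = I + sin θ [u]ₓ + (1 - cos θ)[u]ₓ²`. -/
def Ra (θ : ℝ) (u : V3) : M3 :=
  1 + Real.sin θ • skew u + (1 - Real.cos θ) • (skew u * skew u)

/-- `g(z) = (1/2)(I + [z]ₓ + z zᵀ)`. -/
def gmat (z : V3) : M3 := (2:ℝ)⁻¹ • ((1 : M3) + skew z + vecMulVec z z)

/-- `Ā = (tr(A) I - A)/2`. -/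
def Abar (A : M3) : M3 := (2:ℝ)⁻¹ • (A.trace • (1 : M3) - A)

/-- smallest eigenvalue of a positive-definite symmetric real matrix. -/
def lmin {B : M3} (hB : B.PosDef) : ℝ := ⨅ i, hB.1.eigenvalues i

/-- largest eigenvalue of a positive-definite symmetric real matrix. -/
def lmax {B : M3} (hB : B.PosDef) : ℝ := ⨆ i, hB.1.eigenvalues i

/-- The quadratic form of a Hermitian real matrix, diagonalised in its eigenbasis. -/
theorem exists_eigenvalues_sq_sum {n : Type*} [Fintype n] [DecidableEq n] {B : Matrix n n ℝ}
    (hB : B.IsHermitian) (x : n → ℝ) :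
    ∃ y : n → ℝ, x ⬝ᵥ x = ∑ i, y i ^ 2 ∧ x ⬝ᵥ B *ᵥ x = ∑ i, hB.eigenvalues i * y i ^ 2 := by
  set U : Matrix n n ℝ := (hB.eigenvectorUnitary : Matrix n n ℝ)
  have hUU : U * Uᵀ = 1 := by
    simpa [star_eq_conjTranspose] using Unitary.coe_mul_star_self hB.eigenvectorUnitary
  have hS : B = U * diagonal hB.eigenvalues * Uᵀ := by
    have h := hB.spectral_theorem
    rw [Unitary.conjStarAlgAut_apply] at h
    simpa [star_eq_conjTranspose, Function.comp_def] using h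
  refine ⟨Uᵀ *ᵥ x, ?_, ?_⟩
  · calc x ⬝ᵥ x = x ⬝ᵥ (U * Uᵀ) *ᵥ x := by rw [hUU, one_mulVec]
      _ = (Uᵀ *ᵥ x) ⬝ᵥ (Uᵀ *ᵥ x) := by
        rw [← mulVec_mulVec, dotProduct_mulVec, mulVec_transpose]
      _ = _ := by simp [dotProduct, sq]
  · calc x ⬝ᵥ B *ᵥ x = x ⬝ᵥ (U * diagonal hB.eigenvalues * Uᵀ) *ᵥ x := by rw [← hS]
      _ = (Uᵀ *ᵥ x) ⬝ᵥ diagonal hB.eigenvalues *ᵥ (Uᵀ *ᵥ x) := by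
        rw [← mulVec_mulVec, ← mulVec_mulVec, dotProduct_mulVec, mulVec_transpose]
      _ = _ := by
        simp only [dotProduct, mulVec_diagonal]
        exact Finset.sum_congr rfl fun i _ => by ring

theorem lmin_mul_le {B : M3} (hB : B.PosDef) (x : V3) :
    lmin hB * (x ⬝ᵥ x) ≤ x ⬝ᵥ B *ᵥ x := by
  obtain ⟨y, h1, h2⟩ := exists_eigenvalues_sq_sum hB.1 x
  rw [h1, h2, Finset.mul_sum]
  gcongr with i
  exact ciInf_le (Set.finite_range _).bddBelow i

theorem le_lmax_mul {B : M3} (hB : B.PosDef) (x : V3) :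
    x ⬝ᵥ B *ᵥ x ≤ lmax hB * (x ⬝ᵥ x) := by
  obtain ⟨y, h1, h2⟩ := exists_eigenvalues_sq_sum hB.1 x
  rw [h1, h2, Finset.mul_sum]
  gcongr with i
  exact le_ciSup (Set.finite_range hB.1.eigenvalues).bddAbove i

theorem SO3.mul_transpose {R : M3} (hR : SO3 R) : R * Rᵀ = 1 :=
  mul_eq_one_comm.mp hR.1

theorem SO3.adjugate_eq {R : M3} (hR : SO3 R) : R.adjugate = Rᵀ := by
  calc R.adjugate = Rᵀ * R * R.adjugate := by rw [hR.1, one_mul]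
    _ = Rᵀ := by rw [mul_assoc, mul_adjugate, hR.2, one_smul, mul_one]

theorem trace_mul_self_eq (R : M3) : (R * R).trace = R.trace ^ 2 - 2 * R.adjugate.trace := by
  simp only [trace_fin_three, mul_apply, Fin.sum_univ_three, adjugate_fin_three, of_apply,
    cons_val]
  ring

theorem skew_psi (M : M3) : skew (psi M) = Pa M := by
  ext i j
  fin_cases i <;> fin_cases j <;> simp [skew, psi, vex, Pa] <;> ring

theorem trace_mul_skew (M : M3) (x : V3) : (M * skew x).trace = -2 * (psi M ⬝ᵥ x) := by
  simp [trace_fin_three, mul_apply, Fin.sum_univ_three, skew, psi, vex, Pa, dotProduct]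
  ring

theorem trace_mul_skew_sq (A : M3) (x : V3) :
    (A * (skew x * skew x)).trace = -2 * (x ⬝ᵥ Abar A *ᵥ x) := by
  simp [trace_fin_three, mul_apply, Fin.sum_univ_three, skew, Abar, dotProduct, mulVec,
    Matrix.one_apply]
  ring

theorem psi_dotProduct_psi_mul (A : M3) {R : M3} (hR : SO3 R) :
    psi R ⬝ᵥ psi (A * R) = (A * (1 - R * R)).trace / 4 := by
  have h := trace_mul_skew (A * R) (psi R)
  rw [skew_psi, Pa, Matrix.mul_smul, trace_smul, mul_sub, mul_assoc A R Rᵀ, hR.mul_transpose,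
    dotProduct_comm, smul_eq_mul, trace_sub, mul_assoc A R R, mul_one] at h
  rw [mul_sub, trace_sub, mul_one]
  linarith

theorem trace_mul_one_sub_sq {A R : M3} (hA : A.IsSymm) (hR : SO3 R) :
    (A * (1 - R * R)).trace = 4 * (psi R ⬝ᵥ Abar A *ᵥ psi R) := by
  have h := trace_mul_skew_sq A (psi R)
  have hT : (A * (Rᵀ * Rᵀ)).trace = (A * (R * R)).trace := by
    rw [← transpose_mul, ← trace_transpose, transpose_mul, transpose_transpose, hA.eq,
      trace_mul_comm]
  have hsq : Pa R * Pa R = (4 : ℝ)⁻¹ • (R * R + Rᵀ * Rᵀ - 1 - 1) := by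
    rw [Pa, smul_mul_smul_comm, sub_mul, mul_sub, mul_sub, hR.1, hR.mul_transpose]
    norm_num
    abel
  rw [skew_psi, hsq, Matrix.mul_smul, trace_smul, mul_sub, mul_sub, mul_add, trace_sub, trace_sub,
    trace_add, hT, mul_one, smul_eq_mul] at h
  rw [mul_sub, trace_sub, mul_one]
  linarith

theorem psi_dotProduct_self {R : M3} (hR : SO3 R) :
    psi R ⬝ᵥ psi R = 4 * (1 - normI2 R) * normI2 R := by
  have h := psi_dotProduct_psi_mul 1 hR
  rw [one_mul, one_mul, trace_sub, trace_mul_self_eq, hR.adjugate_eq, trace_transpose] at h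
  rw [h, normI2, trace_sub]
  simp only [trace_one, Fintype.card_fin]
  push_cast
  ring

theorem hasDerivWithinAt_normI2 {R : ℝ → M3} {R' : M3} {s : Set ℝ} {t : ℝ}
    (h : HasDerivWithinAt R R' s t) :
    HasDerivWithinAt (fun u => normI2 (R u)) (-R'.trace / 4) s t := by
  have hd : ∀ i, HasDerivWithinAt (fun u => R u i i) (R' i i) s t := fun i =>
    hasDerivWithinAt_pi.mp (hasDerivWithinAt_pi.mp h i) i
  have hs : HasDerivWithinAt (fun u => (R u).trace) R'.trace s t :=
    HasDerivWithinAt.fun_sum fun i _ => hd i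
  simpa only [normI2, trace_sub] using (hs.const_sub _).div_const 4

/-- along the Filter I error dynamics `R̃' = R̃[σ]ₓ`, `σ = −ψ(AR̃)`,
the function `|R̃|_I²` has derivative `−tr(A(I − R̃²))/8`, bounded between
`−2λ_max(Ā)(1−|R̃|_I²)|R̃|_I²` and `−2λ_min(Ā)(1−|R̃|_I²)|R̃|_I²`. -/
theorem stmt8 (A : M3) (hA : A.IsSymm) (hPD : (Abar A).PosDef)
    (Rt : ℝ → M3) (σ : ℝ → V3) (hσ : ∀ t, σ t = -psi (A * Rt t))
    (hSO : ∀ t, 0 ≤ t → SO3 (Rt t))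
    (hR' : ∀ t, 0 ≤ t → HasDerivWithinAt Rt (Rt t * skew (σ t)) (Set.Ici 0) t)
    (h0 : normI2 (Rt 0) < 1) :
    ∀ t, 0 ≤ t →
      HasDerivWithinAt (fun s => normI2 (Rt s))
        (-(A * (1 - Rt t * Rt t)).trace / 8) (Set.Ici 0) t ∧
      -2 * lmax hPD * (1 - normI2 (Rt t)) * normI2 (Rt t) ≤
        -(A * (1 - Rt t * Rt t)).trace / 8 ∧
      -(A * (1 - Rt t * Rt t)).trace / 8 ≤
        -2 * lmin hPD * (1 - normI2 (Rt t)) * normI2 (Rt t) := by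
  intro t ht
  have hR := hSO t ht
  have hq := trace_mul_one_sub_sq hA hR
  have hn := psi_dotProduct_self hR
  have hlo := lmin_mul_le hPD (psi (Rt t))
  have hhi := le_lmax_mul hPD (psi (Rt t))
  rw [hn] at hlo hhi
  refine ⟨?_, by linarith, by linarith⟩
  convert hasDerivWithinAt_normI2 (hR' t ht) using 1
  rw [trace_mul_skew, hσ, dotProduct_neg, psi_dotProduct_psi_mul A hR]
  ring

end
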